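/- arXiv:1802.03471 — 7 statements merged into one kernel-verified Lean document; each statement's English description precedes it below -/
import Mathlib

section
/- (Robustness Condition.) Let A be a randomized algorithm mapping each x ∈ ℝⁿ to a probability measure on [0,1]^K, satisfying (ε, δ)-differential privacy with respect to the p-norm at distance 1. Fix an input x ∈ ℝⁿ and suppose that for some label k ∈ {1,…,K}: E[A_k(x)] > e^{2ε} · max_{i ≠ k} E[A_i(x)] + (1 + e^ε)·δ. Then for every α ∈ ℝⁿ with ‖α‖_p ≤ 1, E[A_k(x + α)] > max_{i ≠ k} E[A_i(x + α)]; that is, the classifier f(x) = argmax_k E[A_k(x)] is robust to p-norm attacks of size 1 at x. -/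
open MeasureTheory Real
open scoped ENNReal NNReal

theorem expect_le_aux {K : ℕ} (μ ν : Measure (Fin K → ℝ)) [IsProbabilityMeasure μ]
    [IsProbabilityMeasure ν]
    (hμ : ∀ᵐ y ∂μ, ∀ k, y k ∈ Set.Icc (0 : ℝ) 1)
    (hν : ∀ᵐ y ∂ν, ∀ k, y k ∈ Set.Icc (0 : ℝ) 1) (c δ : ℝ)
    (h : ∀ S : Set (Fin K → ℝ), MeasurableSet S → (μ S).toReal ≤ c * (ν S).toReal + δ)
    (i : Fin K) : ∫ y, y i ∂μ ≤ c * ∫ y, y i ∂ν + δ := by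
  have key : ∀ (ρ : Measure (Fin K → ℝ)) [IsProbabilityMeasure ρ],
      (∀ᵐ y ∂ρ, ∀ k, y k ∈ Set.Icc (0 : ℝ) 1) →
      ∫ y, y i ∂ρ = ∫ t in Set.Ioc (0 : ℝ) 1, ρ.real {y | t ≤ y i} := by
    intro ρ _ hρ
    have hint : Integrable (fun y : Fin K → ℝ => y i) ρ := by
      refine Integrable.of_bound (C := 1) (measurable_pi_apply i).aestronglyMeasurable ?_
      filter_upwards [hρ] with y hy
      rw [Real.norm_eq_abs, abs_of_nonneg (hy i).1]
      exact (hy i).2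
    refine hint.integral_eq_integral_Ioc_meas_le ?_ ?_
    · filter_upwards [hρ] with y hy using (hy i).1
    · filter_upwards [hρ] with y hy using (hy i).2
  have hI : ∀ (ρ : Measure (Fin K → ℝ)) [IsProbabilityMeasure ρ],
      IntegrableOn (fun t : ℝ => ρ.real {y | t ≤ y i}) (Set.Ioc 0 1) := by
    intro ρ _
    have hanti : Antitone (fun t : ℝ => ρ.real {y | t ≤ y i}) := by
      intro s t hst
      exact measureReal_mono (fun y hy => le_trans hst hy)
    refine Integrable.of_bound (C := 1) hanti.measurable.aestronglyMeasurable ?_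
    refine Filter.Eventually.of_forall fun t => ?_
    rw [Real.norm_eq_abs, abs_of_nonneg measureReal_nonneg]
    exact measureReal_le_one
  rw [key μ hμ, key ν hν]
  have h2 : ∫ t in Set.Ioc (0 : ℝ) 1, (c * ν.real {y | t ≤ y i} + δ)
      = c * (∫ t in Set.Ioc (0 : ℝ) 1, ν.real {y | t ≤ y i}) + δ := by
    rw [integral_add ((hI ν).const_mul c) (by simp), integral_const_mul]
    simp
  rw [← h2]
  refine integral_mono (hI μ) (((hI ν).const_mul c).add (by simp)) fun t => ?_
  exact h _ (measurableSet_le measurable_const (measurable_pi_apply i))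

/-- **Robustness Condition** (Proposition 1 of the PixelDP paper).
Suppose the randomized scoring function `A`, mapping inputs `x ∈ ℝⁿ` to probability
measures over score vectors in `[0,1]^K`, satisfies `(ε, δ)`-differential privacy with
respect to the `p`-norm at distance `1`.  If for some label `k` the expected score
satisfies `E[A_k(x)] > e^{2ε} · max_{i ≠ k} E[A_i(x)] + (1 + e^ε)·δ`, then for every
perturbation `α` with `‖α‖_p ≤ 1` the expected score of label `k` on `x + α` strictly
dominates the expected score of every other label, i.e. the classifier
`f(x) = argmax_k E[A_k(x)]` is robust to `p`-norm attacks of size `1` at `x`. -/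
theorem pixeldp_robustness_condition
    {n K : ℕ} {p : ℝ≥0∞} [Fact (1 ≤ p)]
    (A : PiLp p (fun _ : Fin n => ℝ) → Measure (Fin K → ℝ))
    [∀ x, IsProbabilityMeasure (A x)]
    (hscores : ∀ x, ∀ᵐ y ∂(A x), ∀ k, y k ∈ Set.Icc (0 : ℝ) 1)
    (ε δ : ℝ) (hε : 0 < ε) (hδ0 : 0 ≤ δ) (hδ1 : δ ≤ 1)
    (hDP : ∀ x x' : PiLp p (fun _ : Fin n => ℝ), ‖x - x'‖ ≤ 1 →
      ∀ S : Set (Fin K → ℝ), MeasurableSet S →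
        ((A x) S).toReal ≤ Real.exp ε * ((A x') S).toReal + δ)
    (x : PiLp p (fun _ : Fin n => ℝ)) (k : Fin K)
    (hgap : ∀ i, i ≠ k →
      ∫ y, y k ∂(A x) > Real.exp (2 * ε) * ∫ y, y i ∂(A x) + (1 + Real.exp ε) * δ) :
    ∀ α : PiLp p (fun _ : Fin n => ℝ), ‖α‖ ≤ 1 →
      ∀ i, i ≠ k → ∫ y, y k ∂(A (x + α)) > ∫ y, y i ∂(A (x + α)) := by
  intro α hα i hi
  have h1 := expect_le_aux (A x) (A (x + α)) (hscores _) (hscores _) (Real.exp ε) δ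
    (hDP _ _ (by simpa using hα)) k
  have h2 := expect_le_aux (A (x + α)) (A x) (hscores _) (hscores _) (Real.exp ε) δ
    (hDP _ _ (by simpa using hα)) i
  have h3 := hgap i hi
  have he : Real.exp (2 * ε) = Real.exp ε * Real.exp ε := by
    rw [← Real.exp_add]; ring_nf
  rw [he] at h3
  have hp := Real.exp_pos ε
  have h4 := mul_le_mul_of_nonneg_left h2 hp.le
  refine lt_of_mul_lt_mul_left ?_ hp.le
  linarith
end

section
/- (Robustness Condition at general attack size.) Let A be a randomized algorithm mapping each x ∈ ℝⁿ to a probability measure on [0,1]^K, satisfying (ε, δ)-differential privacy with respect to the p-norm at distance L (for some fixed L > 0). Fix an input x ∈ ℝⁿ and suppose that for some label k ∈ {1,…,K}: E[A_k(x)] > e^{2ε} · max_{i ≠ k} E[A_i(x)] + (1 + e^ε)·δ. Then for every α ∈ ℝⁿ with ‖α‖_p ≤ L, E[A_k(x + α)] > max_{i ≠ k} E[A_i(x + α)]. -/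
open MeasureTheory Real
open scoped ENNReal NNReal

lemma expectation_dp_bound {K : ℕ} (μ ν : Measure (Fin K → ℝ))
    [IsProbabilityMeasure μ] [IsProbabilityMeasure ν] (i : Fin K)
    (hμ : ∀ᵐ y ∂μ, ∀ k, y k ∈ Set.Icc (0 : ℝ) 1)
    (hν : ∀ᵐ y ∂ν, ∀ k, y k ∈ Set.Icc (0 : ℝ) 1) (c δ : ℝ)
    (h : ∀ S : Set (Fin K → ℝ), MeasurableSet S → (μ S).toReal ≤ c * (ν S).toReal + δ) :
    ∫ y, y i ∂μ ≤ c * ∫ y, y i ∂ν + δ := by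
  have key : ∀ (ρ : Measure (Fin K → ℝ)) [IsProbabilityMeasure ρ],
      (∀ᵐ y ∂ρ, ∀ k, y k ∈ Set.Icc (0 : ℝ) 1) →
      ∫ y, y i ∂ρ = ∫ t in Set.Ioc (0 : ℝ) 1, ρ.real {y | t ≤ y i} ∧
      IntegrableOn (fun t : ℝ => ρ.real {y : Fin K → ℝ | t ≤ y i}) (Set.Ioc 0 1) := by
    intro ρ _ hρ
    have hint : Integrable (fun y : Fin K → ℝ => y i) ρ := by
      refine Integrable.of_bound (measurable_pi_apply i).aestronglyMeasurable 1 ?_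
      filter_upwards [hρ] with y hy
      rw [Real.norm_eq_abs, abs_le]
      constructor <;> linarith [(hy i).1, (hy i).2]
    constructor
    · exact hint.integral_eq_integral_Ioc_meas_le
        (by filter_upwards [hρ] with y hy using (hy i).1)
        (by filter_upwards [hρ] with y hy using (hy i).2)
    · have hanti : Antitone (fun t : ℝ => ρ.real {y : Fin K → ℝ | t ≤ y i}) := by
        intro s t hst
        exact measureReal_mono (fun y (hy : t ≤ y i) => hst.trans hy)
      exact ((hanti.antitoneOn _).integrableOn_isCompact isCompact_Icc).mono_set
        Set.Ioc_subset_Icc_self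
  obtain ⟨e1, i1⟩ := key μ hμ
  obtain ⟨e2, i2⟩ := key ν hν
  have hc : ∫ t in Set.Ioc (0 : ℝ) 1, (δ : ℝ) = δ := by simp
  have hci : IntegrableOn (fun _ : ℝ => δ) (Set.Ioc (0 : ℝ) 1) := by simp
  rw [e1, e2, ← integral_const_mul]
  conv_rhs => rw [← hc]
  rw [← integral_add (i2.const_mul c) hci]
  refine integral_mono i1 ((i2.const_mul c).add hci) ?_
  intro t
  exact h _ (measurableSet_le measurable_const (measurable_pi_apply i))

/-- **Robustness Condition at general attack size** `L` (group-privacy version of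
Proposition 1 of the PixelDP paper).  Suppose the randomized scoring function `A`,
mapping inputs `x ∈ ℝⁿ` to probability measures over score vectors in `[0,1]^K`,
satisfies `(ε, δ)`-differential privacy with respect to the `p`-norm at distance `L`.
If for some label `k` we have `E[A_k(x)] > e^{2ε} · max_{i ≠ k} E[A_i(x)] + (1 + e^ε)·δ`,
then for every `α` with `‖α‖_p ≤ L`, `E[A_k(x + α)] > max_{i ≠ k} E[A_i(x + α)]`. -/
theorem pixeldp_robustness_condition_general_size
    {n K : ℕ} {p : ℝ≥0∞} [Fact (1 ≤ p)]
    (A : PiLp p (fun _ : Fin n => ℝ) → Measure (Fin K → ℝ))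
    [∀ x, IsProbabilityMeasure (A x)]
    (hscores : ∀ x, ∀ᵐ y ∂(A x), ∀ k, y k ∈ Set.Icc (0 : ℝ) 1)
    (L : ℝ) (hL : 0 < L)
    (ε δ : ℝ) (hε : 0 < ε) (hδ0 : 0 ≤ δ) (hδ1 : δ ≤ 1)
    (hDP : ∀ x x' : PiLp p (fun _ : Fin n => ℝ), ‖x - x'‖ ≤ L →
      ∀ S : Set (Fin K → ℝ), MeasurableSet S →
        ((A x) S).toReal ≤ Real.exp ε * ((A x') S).toReal + δ)
    (x : PiLp p (fun _ : Fin n => ℝ)) (k : Fin K)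
    (hgap : ∀ i, i ≠ k →
      ∫ y, y k ∂(A x) > Real.exp (2 * ε) * ∫ y, y i ∂(A x) + (1 + Real.exp ε) * δ) :
    ∀ α : PiLp p (fun _ : Fin n => ℝ), ‖α‖ ≤ L →
      ∀ i, i ≠ k → ∫ y, y k ∂(A (x + α)) > ∫ y, y i ∂(A (x + α)) := by
  intro α hα i hi
  have h1 := expectation_dp_bound (A x) (A (x + α)) k (hscores _) (hscores _) (Real.exp ε) δ
    (hDP x (x + α) (by simpa using hα))
  have h2 := expectation_dp_bound (A (x + α)) (A x) i (hscores _) (hscores _) (Real.exp ε) δ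
    (hDP (x + α) x (by simpa using hα))
  have h3 := hgap i hi
  have he : Real.exp (2 * ε) = Real.exp ε * Real.exp ε := by
    rw [← Real.exp_add]; ring_nf
  rw [he] at h3
  have hpos := Real.exp_pos ε
  have h4 := mul_le_mul_of_nonneg_left h2 hpos.le
  refine lt_of_mul_lt_mul_left ?_ hpos.le
  linarith
end

section
/- (Generalized Robustness Condition, deterministic core.) Let A be a randomized algorithm mapping each x ∈ ℝⁿ to a probability measure on [0,1]^K, satisfying (ε, δ)-differential privacy with respect to the p-norm at distance L. Fix x ∈ ℝⁿ and suppose real numbers Êlb_k and Êub_i (i ≠ k) satisfy Êlb_k ≤ E[A_k(x)] and E[A_i(x)] ≤ Êub_i for all i ≠ k. If Êlb_k > e^{2ε} · max_{i ≠ k} Êub_i + (1 + e^ε)·δ, then for every α ∈ ℝⁿ with ‖α‖_p ≤ L, E[A_k(x + α)] > max_{i ≠ k} E[A_i(x + α)]. -/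
open MeasureTheory Real
open scoped ENNReal NNReal

lemma dp_expectation_bound {K : ℕ} (μ ν : Measure (Fin K → ℝ)) [IsProbabilityMeasure μ]
    [IsProbabilityMeasure ν] (k : Fin K)
    (hμ : ∀ᵐ y ∂μ, ∀ k, y k ∈ Set.Icc (0 : ℝ) 1) (hν : ∀ᵐ y ∂ν, ∀ k, y k ∈ Set.Icc (0 : ℝ) 1)
    (c δ : ℝ)
    (h : ∀ S : Set (Fin K → ℝ), MeasurableSet S → (μ S).toReal ≤ c * (ν S).toReal + δ) :
    ∫ y, y k ∂μ ≤ c * ∫ y, y k ∂ν + δ := by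
  have key : ∀ (ρ : Measure (Fin K → ℝ)) [IsProbabilityMeasure ρ],
      (∀ᵐ y ∂ρ, ∀ k, y k ∈ Set.Icc (0 : ℝ) 1) →
      ∫ y, y k ∂ρ = ∫ t in Set.Ioc (0 : ℝ) 1, ρ.real {y | t ≤ y k} := by
    intro ρ _ hρ
    have hint : Integrable (fun y : Fin K → ℝ => y k) ρ := by
      refine Integrable.of_bound (measurable_pi_apply k).aestronglyMeasurable 1 ?_
      filter_upwards [hρ] with y hy
      rw [Real.norm_eq_abs, abs_of_nonneg (hy k).1]
      exact (hy k).2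
    refine hint.integral_eq_integral_Ioc_meas_le ?_ ?_
    · filter_upwards [hρ] with y hy using (hy k).1
    · filter_upwards [hρ] with y hy using (hy k).2
  have hI : ∀ (ρ : Measure (Fin K → ℝ)) [IsProbabilityMeasure ρ],
      IntegrableOn (fun t : ℝ => ρ.real {y | t ≤ y k}) (Set.Ioc (0 : ℝ) 1) := by
    intro ρ _
    have hanti : Antitone (fun t : ℝ => ρ.real {y | t ≤ y k}) := by
      intro a b hab
      exact measureReal_mono (fun y hy => le_trans hab hy)
    refine Integrable.of_bound hanti.measurable.aestronglyMeasurable 1 ?_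
    filter_upwards with t
    rw [Real.norm_eq_abs, abs_of_nonneg measureReal_nonneg]
    exact measureReal_le_one
  rw [key μ hμ, key ν hν]
  have hc : IntegrableOn (fun _ : ℝ => δ) (Set.Ioc (0 : ℝ) 1) := by simp
  calc ∫ t in Set.Ioc (0 : ℝ) 1, μ.real {y | t ≤ y k}
      ≤ ∫ t in Set.Ioc (0 : ℝ) 1, (c * ν.real {y | t ≤ y k} + δ) := by
        refine integral_mono (hI μ) (((hI ν).const_mul c).add hc) ?_
        intro t
        exact h _ (measurableSet_le measurable_const (measurable_pi_apply k))
    _ = c * (∫ t in Set.Ioc (0 : ℝ) 1, ν.real {y | t ≤ y k}) + δ := by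
        rw [integral_add ((hI ν).const_mul c) hc, integral_const_mul]
        simp

/-- **Generalized Robustness Condition, deterministic core** (Proposition 2 of the
PixelDP paper, with the confidence bounds taken as given).  Suppose the randomized
scoring function `A`, mapping inputs `x ∈ ℝⁿ` to probability measures over score
vectors in `[0,1]^K`, satisfies `(ε, δ)`-differential privacy with respect to the
`p`-norm at distance `L`.  Given real numbers `Êlb_k ≤ E[A_k(x)]` and
`E[A_i(x)] ≤ Êub_i` for `i ≠ k`, if
`Êlb_k > e^{2ε} · max_{i ≠ k} Êub_i + (1 + e^ε)·δ` then for every `α` with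
`‖α‖_p ≤ L`, `E[A_k(x + α)] > max_{i ≠ k} E[A_i(x + α)]`. -/
theorem pixeldp_generalized_robustness_condition
    {n K : ℕ} {p : ℝ≥0∞} [Fact (1 ≤ p)]
    (A : PiLp p (fun _ : Fin n => ℝ) → Measure (Fin K → ℝ))
    [∀ x, IsProbabilityMeasure (A x)]
    (hscores : ∀ x, ∀ᵐ y ∂(A x), ∀ k, y k ∈ Set.Icc (0 : ℝ) 1)
    (L : ℝ) (hL : 0 < L)
    (ε δ : ℝ) (hε : 0 < ε) (hδ0 : 0 ≤ δ) (hδ1 : δ ≤ 1)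
    (hDP : ∀ x x' : PiLp p (fun _ : Fin n => ℝ), ‖x - x'‖ ≤ L →
      ∀ S : Set (Fin K → ℝ), MeasurableSet S →
        ((A x) S).toReal ≤ Real.exp ε * ((A x') S).toReal + δ)
    (x : PiLp p (fun _ : Fin n => ℝ)) (k : Fin K)
    (Elb : ℝ) (Eub : Fin K → ℝ)
    (hlb : Elb ≤ ∫ y, y k ∂(A x))
    (hub : ∀ i, i ≠ k → ∫ y, y i ∂(A x) ≤ Eub i)
    (hgap : ∀ i, i ≠ k → Elb > Real.exp (2 * ε) * Eub i + (1 + Real.exp ε) * δ) :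
    ∀ α : PiLp p (fun _ : Fin n => ℝ), ‖α‖ ≤ L →
      ∀ i, i ≠ k → ∫ y, y k ∂(A (x + α)) > ∫ y, y i ∂(A (x + α)) := by
  intro α hα i hi
  have h1 := dp_expectation_bound (A x) (A (x + α)) k (hscores _) (hscores _) (Real.exp ε) δ
    (hDP x (x + α) (by simpa using hα))
  have h2 := dp_expectation_bound (A (x + α)) (A x) i (hscores _) (hscores _) (Real.exp ε) δ
    (hDP (x + α) x (by simpa using hα))
  have h3 := hgap i hi
  have h4 := hub i hi
  have he : Real.exp (2 * ε) = Real.exp ε * Real.exp ε := by rw [two_mul, Real.exp_add]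
  have hp := Real.exp_pos ε
  rw [he] at h3
  have h5 := mul_le_mul_of_nonneg_left h4 hp.le
  have h6 : Real.exp ε * ∫ y, y i ∂(A (x + α)) ≤ Real.exp ε * (Real.exp ε * Eub i + δ) :=
    mul_le_mul_of_nonneg_left (by linarith) hp.le
  refine lt_of_mul_lt_mul_left ?_ hp.le
  linarith
end

section
/- (General Expected Output Stability Bound.) Let A be a randomized algorithm mapping each x ∈ ℝⁿ to a probability measure A(x) on ℝ supported in [a, b], where a ≤ 0 ≤ b, and satisfying (ε, δ)-differential privacy with respect to the p-norm at distance 1. Write A₊(x) for the pushforward of A(x) under t ↦ max(0, t) and A₋(x) for the pushforward under t ↦ −min(0, t), so E[A(x)] = E[A₊(x)] − E[A₋(x)]. Then for every α ∈ ℝⁿ with ‖α‖_p ≤ 1: (i) E[A(x + α)] ≤ e^ε·E[A₊(x)] − e^{−ε}·E[A₋(x)] + b·δ − e^{−ε}·a·δ, and (ii) E[A(x + α)] ≥ e^{−ε}·E[A₊(x)] − e^ε·E[A₋(x)] − e^{−ε}·b·δ + a·δ. -/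
open MeasureTheory Real
open scoped ENNReal NNReal

lemma dp_integral_le (μ ν : Measure ℝ) [IsProbabilityMeasure μ] [IsProbabilityMeasure ν]
    (f : ℝ → ℝ) (hf : Measurable f) (hf0 : ∀ t, 0 ≤ f t) (c : ℝ) (hc : 0 ≤ c)
    (hμ : ∀ᵐ t ∂μ, f t ≤ c) (hν : ∀ᵐ t ∂ν, f t ≤ c) (k δ : ℝ)
    (h : ∀ S : Set ℝ, MeasurableSet S → (μ S).toReal ≤ k * (ν S).toReal + δ) :
    ∫ t, f t ∂μ ≤ k * ∫ t, f t ∂ν + c * δ := by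
  have int : ∀ (ρ : Measure ℝ) [IsProbabilityMeasure ρ], (∀ᵐ t ∂ρ, f t ≤ c) →
      Integrable f ρ := by
    intro ρ _ hρ
    refine Integrable.of_bound hf.aestronglyMeasurable c ?_
    filter_upwards [hρ] with t ht
    rwa [Real.norm_of_nonneg (hf0 t)]
  have ii : ∀ (ρ : Measure ℝ) [IsProbabilityMeasure ρ],
      IntervalIntegrable (fun t => ρ.real {a : ℝ | t ≤ f a}) volume 0 c := by
    intro ρ _
    apply AntitoneOn.intervalIntegrable
    intro s _ t _ hst
    exact measureReal_mono (fun a (ha : t ≤ f a) => hst.trans ha)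
  rw [(int μ hμ).integral_eq_integral_Ioc_meas_le (Filter.Eventually.of_forall hf0) hμ,
    (int ν hν).integral_eq_integral_Ioc_meas_le (Filter.Eventually.of_forall hf0) hν,
    ← intervalIntegral.integral_of_le hc, ← intervalIntegral.integral_of_le hc]
  calc _ ≤ ∫ t in (0 : ℝ)..c, (k * ν.real {a : ℝ | t ≤ f a} + δ) := by
        apply intervalIntegral.integral_mono_on hc (ii μ)
          (((ii ν).const_mul k).add intervalIntegrable_const)
        intro t _
        exact h _ (measurableSet_le measurable_const hf)
    _ = _ := by
        rw [intervalIntegral.integral_add ((ii ν).const_mul k) intervalIntegrable_const,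
          intervalIntegral.integral_const_mul, intervalIntegral.integral_const]
        simp

/-- **General Expected Output Stability Bound** (Lemma 3 / Appendix of the PixelDP
paper).  Let `A` map inputs `x ∈ ℝⁿ` to probability measures on `ℝ` supported in
`[a, b]` with `a ≤ 0 ≤ b`, and suppose `A` is `(ε, δ)`-differentially private with
respect to the `p`-norm at distance `1`.  Writing `A₊(x)` and `A₋(x)` for the
pushforwards of `A(x)` under `t ↦ max 0 t` and `t ↦ -min 0 t` respectively,
for every `α` with `‖α‖_p ≤ 1`:
`e^{-ε}·E[A₊(x)] - e^ε·E[A₋(x)] - e^{-ε}·b·δ + a·δ ≤ E[A(x + α)]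
  ≤ e^ε·E[A₊(x)] - e^{-ε}·E[A₋(x)] + b·δ - e^{-ε}·a·δ`. -/
theorem general_expected_output_stability_bound
    {n : ℕ} {p : ℝ≥0∞} [Fact (1 ≤ p)]
    (A : PiLp p (fun _ : Fin n => ℝ) → Measure ℝ)
    [∀ x, IsProbabilityMeasure (A x)]
    (a b : ℝ) (ha : a ≤ 0) (hb : 0 ≤ b)
    (hsupp : ∀ x, ∀ᵐ t ∂(A x), t ∈ Set.Icc a b)
    (ε δ : ℝ) (hε : 0 < ε) (hδ0 : 0 ≤ δ) (hδ1 : δ ≤ 1)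
    (hDP : ∀ x x' : PiLp p (fun _ : Fin n => ℝ), ‖x - x'‖ ≤ 1 →
      ∀ S : Set ℝ, MeasurableSet S →
        ((A x) S).toReal ≤ Real.exp ε * ((A x') S).toReal + δ)
    (x α : PiLp p (fun _ : Fin n => ℝ)) (hα : ‖α‖ ≤ 1) :
    (∫ t, t ∂(A (x + α)) ≤
        Real.exp ε * (∫ t, t ∂((A x).map (fun t => max 0 t)))
          - Real.exp (-ε) * (∫ t, t ∂((A x).map (fun t => -min 0 t)))
          + b * δ - Real.exp (-ε) * a * δ) ∧
    (∫ t, t ∂(A (x + α)) ≥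
        Real.exp (-ε) * (∫ t, t ∂((A x).map (fun t => max 0 t)))
          - Real.exp ε * (∫ t, t ∂((A x).map (fun t => -min 0 t)))
          - Real.exp (-ε) * b * δ + a * δ) := by
  have mp : Measurable (fun t : ℝ => max 0 t) := by fun_prop
  have mn : Measurable (fun t : ℝ => -min 0 t) := by fun_prop
  have bp : ∀ y, ∀ᵐ t ∂(A y), max 0 t ≤ b := fun y => by
    filter_upwards [hsupp y] with t ht
    exact max_le hb ht.2
  have bn : ∀ y, ∀ᵐ t ∂(A y), -min 0 t ≤ -a := fun y => by
    filter_upwards [hsupp y] with t ht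
    exact neg_le_neg (le_min ha ht.1)
  have p0 : ∀ t : ℝ, 0 ≤ max 0 t := fun t => le_max_left _ _
  have n0 : ∀ t : ℝ, 0 ≤ -min 0 t := fun t => neg_nonneg.2 (min_le_left _ _)
  have d1 := hDP (x + α) x (by simpa using hα)
  have d2 := hDP x (x + α) (by simpa using hα)
  have hP1 := dp_integral_le _ _ _ mp p0 b hb (bp _) (bp _) _ _ d1
  have hP2 := dp_integral_le _ _ _ mp p0 b hb (bp _) (bp _) _ _ d2
  have hN1 := dp_integral_le _ _ _ mn n0 (-a) (by linarith) (bn _) (bn _) _ _ d1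
  have hN2 := dp_integral_le _ _ _ mn n0 (-a) (by linarith) (bn _) (bn _) _ _ d2
  have hE : ∫ t, t ∂(A (x + α)) =
      ∫ t, max 0 t ∂(A (x + α)) - ∫ t, -min 0 t ∂(A (x + α)) := by
    rw [← integral_sub]
    · congr 1
      ext t
      have := max_add_min 0 t
      linarith
    · refine Integrable.of_bound mp.aestronglyMeasurable b ?_
      filter_upwards [bp (x + α)] with t ht
      rwa [Real.norm_of_nonneg (p0 t)]
    · refine Integrable.of_bound mn.aestronglyMeasurable (-a) ?_
      filter_upwards [bn (x + α)] with t ht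
      rwa [Real.norm_of_nonneg (n0 t)]
  rw [integral_map mp.aemeasurable (by fun_prop), integral_map mn.aemeasurable (by fun_prop), hE]
  generalize ∫ t, max 0 t ∂(A (x + α)) = P' at *
  generalize ∫ t, -min 0 t ∂(A (x + α)) = N' at *
  generalize ∫ t, max 0 t ∂(A x) = P at *
  generalize ∫ t, -min 0 t ∂(A x) = N at *
  have he : Real.exp (-ε) * Real.exp ε = 1 := by rw [← Real.exp_add]; simp
  have hpos := (Real.exp_pos (-ε)).le
  have hP2' := mul_le_mul_of_nonneg_left hP2 hpos
  have hN2' := mul_le_mul_of_nonneg_left hN2 hpos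
  rw [mul_add, ← mul_assoc, he] at hP2' hN2'
  constructor <;> linarith
end

section
/- (Positive-part stability, intermediate step of the General Expected Output Stability Bound.) Let A be a randomized algorithm mapping each x ∈ ℝⁿ to a probability measure on ℝ supported in [a, b] with a ≤ 0 ≤ b, satisfying (ε, δ)-differential privacy with respect to the p-norm at distance 1. Let A₊(x) be the pushforward of A(x) under t ↦ max(0, t). Then for every α with ‖α‖_p ≤ 1, writing x' = x + α: E[A₊(x')] ≤ e^ε·E[A₊(x)] + b·δ, and E[A₊(x')] ≥ e^{−ε}·E[A₊(x)] − e^{−ε}·b·δ. -/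
open MeasureTheory Real
open scoped ENNReal NNReal

lemma layer_cake_pos (μ : Measure ℝ) [IsProbabilityMeasure μ] (a b : ℝ) (hb : 0 ≤ b)
    (hs : ∀ᵐ t ∂μ, t ∈ Set.Icc a b) :
    ∫ t, t ∂(μ.map (fun t => max 0 t)) =
      ∫ t in Set.Ioc 0 b, μ.real {s : ℝ | t ≤ max 0 s} := by
  have hm : Measurable (fun t : ℝ => max 0 t) := measurable_const.max measurable_id
  rw [integral_map (f := fun t : ℝ => t) hm.aemeasurable measurable_id.aestronglyMeasurable]
  refine Integrable.integral_eq_integral_Ioc_meas_le ?_ ?_ ?_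
  · refine Integrable.of_bound hm.aestronglyMeasurable b ?_
    filter_upwards [hs] with t ht
    rw [Real.norm_eq_abs, abs_of_nonneg (le_max_left _ _)]
    exact max_le hb ht.2
  · exact Filter.Eventually.of_forall fun t => le_max_left _ _
  · filter_upwards [hs] with t ht
    exact max_le hb ht.2

lemma layer_integrable (μ : Measure ℝ) [IsProbabilityMeasure μ] (b : ℝ) :
    IntegrableOn (fun t : ℝ => μ.real {s : ℝ | t ≤ max 0 s}) (Set.Ioc 0 b) := by
  have hanti : Antitone (fun t : ℝ => μ.real {s : ℝ | t ≤ max 0 s}) := by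
    intro t u htu
    exact measureReal_mono (fun s hs => le_trans htu hs)
  refine Integrable.of_bound hanti.measurable.aestronglyMeasurable 1 ?_
  refine Filter.Eventually.of_forall fun t => ?_
  rw [Real.norm_eq_abs, abs_of_nonneg measureReal_nonneg]
  exact measureReal_le_one

lemma pos_part_one_side (μ ν : Measure ℝ) [IsProbabilityMeasure μ] [IsProbabilityMeasure ν]
    (a b : ℝ) (hb : 0 ≤ b)
    (hμ : ∀ᵐ t ∂μ, t ∈ Set.Icc a b) (hν : ∀ᵐ t ∂ν, t ∈ Set.Icc a b) (ε δ : ℝ)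
    (h : ∀ S : Set ℝ, MeasurableSet S → (μ S).toReal ≤ Real.exp ε * (ν S).toReal + δ) :
    ∫ t, t ∂(μ.map (fun t => max 0 t)) ≤
      Real.exp ε * (∫ t, t ∂(ν.map (fun t => max 0 t))) + b * δ := by
  have hm : Measurable (fun t : ℝ => max 0 t) := measurable_const.max measurable_id
  rw [layer_cake_pos μ a b hb hμ, layer_cake_pos ν a b hb hν]
  have hc : IntegrableOn (fun _ : ℝ => δ) (Set.Ioc 0 b) := by simp
  have hi := (layer_integrable ν b).const_mul (Real.exp ε)
  calc ∫ t in Set.Ioc 0 b, μ.real {s : ℝ | t ≤ max 0 s}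
      ≤ ∫ t in Set.Ioc 0 b, (Real.exp ε * ν.real {s : ℝ | t ≤ max 0 s} + δ) := by
        refine integral_mono (layer_integrable μ b) (hi.add hc) fun t => ?_
        exact h _ (measurableSet_le measurable_const hm)
    _ = _ := by
        rw [integral_add hi hc, integral_const_mul]
        simp [hb]

/-- **Positive-part stability** (intermediate step of the General Expected Output
Stability Bound of the PixelDP paper).  Let `A` map inputs `x ∈ ℝⁿ` to probability
measures on `ℝ` supported in `[a, b]` with `a ≤ 0 ≤ b`, and suppose `A` is
`(ε, δ)`-differentially private with respect to the `p`-norm at distance `1`.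
Writing `A₊(x)` for the pushforward of `A(x)` under `t ↦ max 0 t`, for every `α`
with `‖α‖_p ≤ 1` and `x' = x + α`:
`E[A₊(x')] ≤ e^ε·E[A₊(x)] + b·δ` and `E[A₊(x')] ≥ e^{-ε}·E[A₊(x)] - e^{-ε}·b·δ`. -/
theorem positive_part_stability_bound
    {n : ℕ} {p : ℝ≥0∞} [Fact (1 ≤ p)]
    (A : PiLp p (fun _ : Fin n => ℝ) → Measure ℝ)
    [∀ x, IsProbabilityMeasure (A x)]
    (a b : ℝ) (ha : a ≤ 0) (hb : 0 ≤ b)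
    (hsupp : ∀ x, ∀ᵐ t ∂(A x), t ∈ Set.Icc a b)
    (ε δ : ℝ) (hε : 0 < ε) (hδ0 : 0 ≤ δ) (hδ1 : δ ≤ 1)
    (hDP : ∀ x x' : PiLp p (fun _ : Fin n => ℝ), ‖x - x'‖ ≤ 1 →
      ∀ S : Set ℝ, MeasurableSet S →
        ((A x) S).toReal ≤ Real.exp ε * ((A x') S).toReal + δ)
    (x α : PiLp p (fun _ : Fin n => ℝ)) (hα : ‖α‖ ≤ 1) :
    (∫ t, t ∂((A (x + α)).map (fun t => max 0 t)) ≤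
        Real.exp ε * (∫ t, t ∂((A x).map (fun t => max 0 t))) + b * δ) ∧
    (∫ t, t ∂((A (x + α)).map (fun t => max 0 t)) ≥
        Real.exp (-ε) * (∫ t, t ∂((A x).map (fun t => max 0 t)))
          - Real.exp (-ε) * b * δ) := by
  have h1 := pos_part_one_side (A (x + α)) (A x) a b hb (hsupp _) (hsupp _) ε δ
    (hDP _ _ (by simpa using hα))
  have h2 := pos_part_one_side (A x) (A (x + α)) a b hb (hsupp _) (hsupp _) ε δ
    (hDP _ _ (by simpa using hα))
  refine ⟨h1, ?_⟩
  have h3 := mul_le_mul_of_nonneg_left h2 (Real.exp_pos (-ε)).le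
  have h4 : Real.exp (-ε) * Real.exp ε = 1 := by rw [← Real.exp_add]; simp
  rw [mul_add, ← mul_assoc, h4, one_mul, ← mul_assoc] at h3
  linarith
end

section
/- (Negative-part stability, intermediate step of the General Expected Output Stability Bound.) Let A be a randomized algorithm mapping each x ∈ ℝⁿ to a probability measure on ℝ supported in [a, b] with a ≤ 0 ≤ b, satisfying (ε, δ)-differential privacy with respect to the p-norm at distance 1. Let A₋(x) be the pushforward of A(x) under t ↦ −min(0, t). Then for every α with ‖α‖_p ≤ 1, writing x' = x + α: E[A₋(x')] ≤ e^ε·E[A₋(x)] − a·δ, and E[A₋(x')] ≥ e^{−ε}·E[A₋(x)] + e^{−ε}·a·δ. -/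
open MeasureTheory Real
open scoped ENNReal NNReal

lemma layer_aux (μ ν : Measure ℝ) [IsProbabilityMeasure μ] [IsProbabilityMeasure ν]
    (f : ℝ → ℝ) (hf : Measurable f) (h0 : ∀ t, 0 ≤ f t) (M c δ : ℝ) (hM : 0 ≤ M)
    (hμ : ∀ᵐ t ∂μ, f t ≤ M) (hν : ∀ᵐ t ∂ν, f t ≤ M)
    (h : ∀ S : Set ℝ, MeasurableSet S → (μ S).toReal ≤ c * (ν S).toReal + δ) :
    ∫ t, f t ∂μ ≤ c * ∫ t, f t ∂ν + M * δ := by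
  have key : ∀ (ρ : Measure ℝ) [IsProbabilityMeasure ρ], (∀ᵐ t ∂ρ, f t ≤ M) →
      ∫ t, f t ∂ρ = ∫ s in Set.Ioc 0 M, ρ.real {t | s ≤ f t} := by
    intro ρ _ hρ
    have hi : Integrable f ρ := by
      refine Integrable.of_bound hf.aestronglyMeasurable M ?_
      filter_upwards [hρ] with t ht
      rwa [Real.norm_of_nonneg (h0 t)]
    exact hi.integral_eq_integral_Ioc_meas_le (Filter.Eventually.of_forall h0) hρ
  have int : ∀ (ρ : Measure ℝ) [IsProbabilityMeasure ρ],
      IntegrableOn (fun s => ρ.real {t | s ≤ f t}) (Set.Ioc 0 M) := by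
    intro ρ _
    have hanti : Antitone (fun s => ρ.real {t | s ≤ f t}) := by
      intro s s' hs
      exact measureReal_mono (fun t ht => le_trans hs ht)
    exact (hanti.antitoneOn (Set.Icc 0 M)).integrableOn_isCompact isCompact_Icc
      |>.mono_set Set.Ioc_subset_Icc_self
  rw [key μ hμ, key ν hν]
  have hc : ∫ _ in Set.Ioc 0 M, δ = M * δ := by
    simp [hM]
  rw [← hc, ← integral_const_mul, ← integral_add ((int ν).const_mul c) (integrable_const δ)]
  refine integral_mono (int μ) (((int ν).const_mul c).add (integrable_const δ)) ?_
  intro s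
  exact h _ (measurableSet_le measurable_const hf)

/-- **Negative-part stability** (intermediate step of the General Expected Output
Stability Bound of the PixelDP paper).  Let `A` map inputs `x ∈ ℝⁿ` to probability
measures on `ℝ` supported in `[a, b]` with `a ≤ 0 ≤ b`, and suppose `A` is
`(ε, δ)`-differentially private with respect to the `p`-norm at distance `1`.
Writing `A₋(x)` for the pushforward of `A(x)` under `t ↦ -min 0 t`, for every `α`
with `‖α‖_p ≤ 1` and `x' = x + α`:
`E[A₋(x')] ≤ e^ε·E[A₋(x)] - a·δ` and `E[A₋(x')] ≥ e^{-ε}·E[A₋(x)] + e^{-ε}·a·δ`. -/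
theorem negative_part_stability_bound
    {n : ℕ} {p : ℝ≥0∞} [Fact (1 ≤ p)]
    (A : PiLp p (fun _ : Fin n => ℝ) → Measure ℝ)
    [∀ x, IsProbabilityMeasure (A x)]
    (a b : ℝ) (ha : a ≤ 0) (hb : 0 ≤ b)
    (hsupp : ∀ x, ∀ᵐ t ∂(A x), t ∈ Set.Icc a b)
    (ε δ : ℝ) (hε : 0 < ε) (hδ0 : 0 ≤ δ) (hδ1 : δ ≤ 1)
    (hDP : ∀ x x' : PiLp p (fun _ : Fin n => ℝ), ‖x - x'‖ ≤ 1 →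
      ∀ S : Set ℝ, MeasurableSet S →
        ((A x) S).toReal ≤ Real.exp ε * ((A x') S).toReal + δ)
    (x α : PiLp p (fun _ : Fin n => ℝ)) (hα : ‖α‖ ≤ 1) :
    (∫ t, t ∂((A (x + α)).map (fun t => -min 0 t)) ≤
        Real.exp ε * (∫ t, t ∂((A x).map (fun t => -min 0 t))) - a * δ) ∧
    (∫ t, t ∂((A (x + α)).map (fun t => -min 0 t)) ≥
        Real.exp (-ε) * (∫ t, t ∂((A x).map (fun t => -min 0 t)))
          + Real.exp (-ε) * a * δ) := by
  have hm : Measurable (fun t : ℝ => -min 0 t) := by fun_prop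
  have e : ∀ y, ∫ t, t ∂((A y).map (fun t => -min 0 t)) = ∫ t, -min 0 t ∂(A y) := fun y =>
    integral_map hm.aemeasurable aestronglyMeasurable_id
  have h0 : ∀ t : ℝ, 0 ≤ -min 0 t := fun t => by simp
  have hB : ∀ y, ∀ᵐ t ∂(A y), -min 0 t ≤ -a := by
    intro y
    filter_upwards [hsupp y] with t ht
    exact neg_le_neg (le_min ha ht.1)
  rw [e, e]
  have h1 := layer_aux (A (x + α)) (A x) _ hm h0 (-a) (Real.exp ε) δ (by linarith) (hB _) (hB _)
    (hDP _ _ (by simpa using hα))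
  have h2 := layer_aux (A x) (A (x + α)) _ hm h0 (-a) (Real.exp ε) δ (by linarith) (hB _) (hB _)
    (hDP _ _ (by simpa using hα))
  refine ⟨by linarith, ?_⟩
  have h3 := mul_le_mul_of_nonneg_left h2 (Real.exp_pos (-ε)).le
  have h4 : Real.exp (-ε) * Real.exp ε = 1 := by rw [← Real.exp_add]; simp
  rw [mul_add, ← mul_assoc, h4] at h3
  linarith
end

section
/- (Gaussian mechanism, as used in the PixelDP noise layer.) Let g : ℝⁿ → ℝ^m satisfy ‖g(x) − g(x')‖₂ ≤ Δ·‖x − x'‖_p for all x, x' (i.e., g has (p,2)-sensitivity at most Δ). Fix ε ∈ (0, 1], δ ∈ (0, 1), L > 0, and let σ = √(2·ln(1.25/δ))·Δ·L/ε. Let A(x) be the law of g(x) + Z, where Z = (Z₁,…,Z_m) has independent coordinates each distributed as the Gaussian measure on ℝ with mean 0 and variance σ². Then A satisfies (ε, δ)-differential privacy with respect to the p-norm at distance L: for all x, x' with ‖x − x'‖_p ≤ L and all measurable S ⊆ ℝ^m, A(x)(S) ≤ e^ε · A(x')(S) + δ. -/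
open MeasureTheory ProbabilityTheory Real
open scoped ENNReal NNReal

/-- The `m`-dimensional Gaussian noise measure of standard deviation `σ`: the product
over the `m` coordinates of the one-dimensional Gaussian measure with mean `0` and
variance `σ²`. -/
noncomputable def gaussianNoise (m : ℕ) (σ : ℝ) : Measure (Fin m → ℝ) :=
  Measure.pi (fun _ : Fin m => gaussianReal 0 ((σ ^ 2).toNNReal))


lemma pixeldp_pi_withDensity {m : ℕ} (μ : Fin m → Measure ℝ) [∀ i, IsProbabilityMeasure (μ i)]
    (f : Fin m → ℝ → ℝ≥0∞) (hf : ∀ i, Measurable (f i))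
    [∀ i, SigmaFinite ((μ i).withDensity (f i))] :
    Measure.pi (fun i => (μ i).withDensity (f i))
      = (Measure.pi μ).withDensity (fun z => ∏ i, f i (z i)) := by
  refine Measure.pi_eq (fun s hs => ?_)
  rw [withDensity_apply _ (MeasurableSet.univ_pi hs),
    ← lintegral_indicator (MeasurableSet.univ_pi hs)]
  have h1 : (Set.univ.pi s).indicator (fun z : Fin m → ℝ => ∏ i, f i (z i))
      = fun z => ∏ i, (s i).indicator (f i) (z i) := by
    ext z
    by_cases hz : z ∈ Set.univ.pi s
    · rw [Set.indicator_of_mem hz]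
      refine Finset.prod_congr rfl (fun i _ => ?_)
      rw [Set.indicator_of_mem (hz i (Set.mem_univ i))]
    · rw [Set.indicator_of_notMem hz]
      simp only [Set.mem_pi, Set.mem_univ, true_imp_iff, not_forall] at hz
      obtain ⟨i, hi⟩ := hz
      exact (Finset.prod_eq_zero (Finset.mem_univ i) (Set.indicator_of_notMem hi _)).symm
  have hm : ∀ i, Measurable ((s i).indicator (f i)) := fun i => (hf i).indicator (hs i)
  rw [h1, lintegral_prod_eq_prod_lintegral_of_indepFun Finset.univ
    (fun i (z : Fin m → ℝ) => (s i).indicator (f i) (z i))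
    (iIndepFun_pi (fun i => (hm i).aemeasurable))
    (fun i => (hm i).comp (measurable_pi_apply i))]
  refine Finset.prod_congr rfl (fun i _ => ?_)
  rw [withDensity_apply _ (hs i), ← lintegral_indicator (hs i)]
  exact ((measurePreserving_eval μ i).lintegral_comp (hm i))

lemma pixeldp_gaussian_density (s : ℝ≥0) (hs : s ≠ 0) (v : ℝ) :
    gaussianReal v s = (gaussianReal 0 s).withDensity
      (fun z => ENNReal.ofReal (Real.exp ((v * z - v ^ 2 / 2) / s))) := by
  rw [gaussianReal_of_var_ne_zero _ hs, gaussianReal_of_var_ne_zero _ hs,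
    ← withDensity_mul _ (by fun_prop) (by fun_prop)]
  congr 1
  ext z
  simp only [Pi.mul_apply, gaussianPDF, gaussianPDFReal]
  rw [← ENNReal.ofReal_mul (by positivity), mul_assoc (√(2 * π * (s : ℝ)))⁻¹, ← Real.exp_add]
  have : (s : ℝ) ≠ 0 := by exact_mod_cast hs
  congr 3
  field_simp
  ring

lemma pixeldp_map_shift {m : ℕ} (s : ℝ≥0) (hs : s ≠ 0) (v : Fin m → ℝ) :
    (Measure.pi (fun _ : Fin m => gaussianReal 0 s)).map (fun z => v + z)
      = (Measure.pi (fun _ : Fin m => gaussianReal 0 s)).withDensity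
        (fun z => ENNReal.ofReal (Real.exp ((∑ i, v i * z i - (∑ i, v i ^ 2) / 2) / s))) := by
  have h1 : (Measure.pi (fun _ : Fin m => gaussianReal 0 s)).map (fun z => v + z)
      = Measure.pi (fun i : Fin m => gaussianReal (v i) s) := by
    have := Measure.pi_map_pi (μ := fun _ : Fin m => gaussianReal 0 s)
      (f := fun i x => v i + x) (fun i => by fun_prop)
    simp only [gaussianReal_map_const_add, zero_add] at this
    exact this
  rw [h1]
  have h2 : (fun i : Fin m => gaussianReal (v i) s) = fun i => (gaussianReal 0 s).withDensity
      (fun z => ENNReal.ofReal (Real.exp ((v i * z - v i ^ 2 / 2) / s))) := by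
    ext1 i; exact pixeldp_gaussian_density s hs (v i)
  have : ∀ i, SigmaFinite ((gaussianReal 0 s).withDensity
      (fun z => ENNReal.ofReal (Real.exp ((v i * z - v i ^ 2 / 2) / s)))) := by
    intro i; rw [← pixeldp_gaussian_density s hs (v i)]; infer_instance
  rw [h2, pixeldp_pi_withDensity (fun _ => gaussianReal 0 s)
    (fun i z => ENNReal.ofReal (Real.exp ((v i * z - v i ^ 2 / 2) / s))) (fun i => by fun_prop)]
  congr 1
  ext z
  rw [← ENNReal.ofReal_prod_of_nonneg (fun i _ => by positivity), ← Real.exp_sum,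
    ← Finset.sum_div, Finset.sum_sub_distrib, Finset.sum_div]

lemma pixeldp_map_inner {m : ℕ} (s : ℝ≥0) (v : Fin m → ℝ) :
    (Measure.pi (fun _ : Fin m => gaussianReal 0 s)).map (fun z => ∑ i, v i * z i)
      = gaussianReal 0 ((∑ i, v i ^ 2).toNNReal * s) := by
  refine Measure.ext_of_charFun ?_
  have hI : iIndepFun (fun (i : Fin m) (z : Fin m → ℝ) => v i * z i)
      (Measure.pi (fun _ : Fin m => gaussianReal 0 s)) :=
    iIndepFun_pi (X := fun i x => v i * x) (fun i => by fun_prop)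
  rw [iIndepFun.charFun_map_fun_sum_eq_prod
    (fun i => ((measurable_pi_apply i).const_mul (v i)).aemeasurable) hI]
  have h : ∀ i, (Measure.pi (fun _ : Fin m => gaussianReal 0 s)).map (fun z => v i * z i)
      = gaussianReal 0 (.mk (v i ^ 2) (sq_nonneg _) * s) := by
    intro i
    have := (measurePreserving_eval (fun _ : Fin m => gaussianReal 0 s) i).map_eq
    have h2 := gaussianReal_map_const_mul (μ := 0) (v := s) (v i)
    rw [← this, Measure.map_map (by fun_prop) (by fun_prop), mul_zero] at h2
    exact h2
  ext t
  simp_rw [h]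
  rw [Finset.prod_apply]
  simp_rw [charFun_gaussianReal]
  rw [← Complex.exp_sum]
  congr 1
  have h0 : 0 ≤ ∑ i, v i ^ 2 := Finset.sum_nonneg (fun i _ => sq_nonneg _)
  simp [Real.coe_toNNReal _ h0, Finset.sum_mul, Finset.sum_div]

lemma pixeldp_half (V : ℝ≥0) : (gaussianReal 0 V).real (Set.Ioi 0) ≤ 1 / 2 := by
  have h1 : (gaussianReal 0 V).real (Set.Iio 0) = (gaussianReal 0 V).real (Set.Ioi 0) := by
    conv_rhs => rw [← neg_zero, ← gaussianReal_map_neg]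
    rw [map_measureReal_apply (by fun_prop) measurableSet_Ioi]
    simp
  have h2 := measureReal_union (μ := gaussianReal 0 V) (s₁ := Set.Iio 0) (s₂ := Set.Ioi (0:ℝ))
    (by rw [Set.disjoint_left]; intro x hx hy; exact lt_asymm (Set.mem_Iio.mp hx) (Set.mem_Ioi.mp hy)) measurableSet_Ioi
  have h3 : (gaussianReal 0 V).real (Set.Iio 0 ∪ Set.Ioi (0:ℝ)) ≤ 1 := measureReal_le_one
  linarith

lemma pixeldp_tail_pos (V : ℝ≥0) (hV : V ≠ 0) (a : ℝ) (ha : 0 ≤ a) :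
    (gaussianReal 0 V).real (Set.Ioi a) ≤ 1 / 2 * Real.exp (- a ^ 2 / (2 * V)) := by
  have hV' : (0:ℝ) < V := by positivity
  have h1 : (gaussianReal 0 V) (Set.Ioi a) = gaussianReal (-a) V (Set.Ioi 0) := by
    have := gaussianReal_map_sub_const (μ := 0) (v := V) a
    rw [zero_sub] at this
    rw [← this, Measure.map_apply (by fun_prop) measurableSet_Ioi]
    simp
  have h2 : gaussianReal (-a) V (Set.Ioi 0)
      ≤ ENNReal.ofReal (Real.exp (- a ^ 2 / (2 * V))) * gaussianReal 0 V (Set.Ioi 0) := by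
    rw [pixeldp_gaussian_density V hV (-a), withDensity_apply _ measurableSet_Ioi,
      ← setLIntegral_const]
    refine setLIntegral_mono (by fun_prop) (fun x hx => ?_)
    apply ENNReal.ofReal_le_ofReal
    apply Real.exp_le_exp.mpr
    have : (0:ℝ) < x := hx
    rw [div_le_div_iff₀ (by positivity) (by positivity)]
    nlinarith [mul_nonneg (mul_nonneg ha this.le) hV'.le]
  rw [Measure.real, h1]
  have h3 := ENNReal.toReal_mono (by finiteness) h2
  rw [ENNReal.toReal_mul, ENNReal.toReal_ofReal (by positivity)] at h3
  have := mul_le_mul_of_nonneg_left (pixeldp_half V) (Real.exp_pos (- a ^ 2 / (2 * V))).le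
  rw [Measure.real] at this
  linarith

lemma pixeldp_tail_neg (V : ℝ≥0) (hV : V ≠ 0) (a : ℝ) (ha : 0 ≤ a) :
    (gaussianReal 0 V).real (Set.Ioi (-a)) ≤ 1 / 2 + a / Real.sqrt V := by
  have hV' : (0:ℝ) < V := by positivity
  have hu : Set.Ioi (-a) = Set.Ioc (-a) 0 ∪ Set.Ioi 0 :=
    (Set.Ioc_union_Ioi_eq_Ioi (by linarith)).symm
  have h1 : gaussianReal 0 V (Set.Ioc (-a) 0) ≤ ENNReal.ofReal (a / Real.sqrt V) := by
    rw [gaussianReal_apply _ hV]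
    calc _ ≤ ∫⁻ x in Set.Ioc (-a) 0, ENNReal.ofReal (1 / Real.sqrt V) := by
          refine setLIntegral_mono (by fun_prop) (fun x hx => ?_)
          apply ENNReal.ofReal_le_ofReal
          rw [gaussianPDFReal, one_div]
          have e1 : Real.exp (-(x - 0) ^ 2 / (2 * V)) ≤ 1 := by
            apply Real.exp_le_one_iff.mpr
            apply div_nonpos_of_nonpos_of_nonneg
            · nlinarith [sq_nonneg (x-0)]
            · positivity
          have e2 : (Real.sqrt (2 * π * V))⁻¹ ≤ (Real.sqrt V)⁻¹ := by
            apply inv_anti₀ (Real.sqrt_pos.mpr hV')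
            apply Real.sqrt_le_sqrt
            nlinarith [Real.pi_gt_three]
          calc _ ≤ (Real.sqrt (2 * π * V))⁻¹ * 1 := by gcongr
            _ ≤ _ := by linarith
      _ = _ := by
          rw [setLIntegral_const, Real.volume_Ioc, ← ENNReal.ofReal_mul (by positivity)]
          congr 1; ring
  have h2 : (gaussianReal 0 V).real (Set.Ioc (-a) 0) ≤ a / Real.sqrt V :=
    ENNReal.toReal_le_of_le_ofReal (by positivity) h1
  rw [hu]
  have := measureReal_union_le (μ := gaussianReal 0 V) (Set.Ioc (-a) 0) (Set.Ioi 0)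
  linarith [pixeldp_half V]

/-- The tail estimate: `c2 = 2 log (1.25/δ)`, `q = ‖v‖²`. -/
lemma pixeldp_tail (s q : ℝ≥0) (hs : s ≠ 0) (hq : q ≠ 0) (ε δ : ℝ) (hε0 : 0 < ε) (hε1 : ε ≤ 1)
    (hδ0 : 0 < δ) (hδ1 : δ < 1)
    (h : 2 * Real.log (1.25 / δ) * q ≤ s * ε ^ 2) :
    (gaussianReal 0 (q * s)).real (Set.Ioi (ε * s - q / 2)) ≤ δ := by
  have hs' : (0:ℝ) < s := by positivity
  have hq' : (0:ℝ) < q := by positivity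
  have hV : q * s ≠ 0 := mul_ne_zero hq hs
  set l := Real.log (1.25 / δ) with hl
  have hδl : δ = 1.25 * Real.exp (-l) := by
    rw [hl, Real.exp_neg, Real.exp_log (by positivity)]
    field_simp
  have hl0 : 0.2 ≤ l := by
    have : 1 - (1.25 / δ)⁻¹ ≤ l := Real.one_sub_inv_le_log_of_pos (by positivity)
    have h2 : (1.25 / δ)⁻¹ = 0.8 * δ := by rw [inv_div]; ring
    rw [h2] at this
    linarith
  rcases le_or_gt 0 (ε * s - q / 2) with ha | ha
  · refine (pixeldp_tail_pos _ hV _ ha).trans ?_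
    have e1 : -(ε * s - q / 2) ^ 2 / (2 * ((q * s : ℝ≥0) : ℝ)) ≤ 1 / 2 - l := by
      push_cast
      rw [div_le_iff₀ (by positivity)]
      nlinarith [mul_le_mul_of_nonneg_right h hs'.le,
        mul_nonneg (sub_nonneg.mpr hε1) (mul_pos hq' hs').le, sq_nonneg (q:ℝ)]
    have e2 : Real.exp (1 / 2) ≤ 2.5 := by
      have : Real.exp (1/2) ≤ Real.exp 1 := Real.exp_le_exp.mpr (by norm_num)
      have h3 : Real.exp (1/2) * Real.exp (1/2) = Real.exp 1 := by
        rw [← Real.exp_add]; norm_num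
      nlinarith [Real.exp_one_lt_d9, Real.exp_pos (1/2)]
    have e3 : Real.exp (1 / 2 - l) = Real.exp (1/2) * Real.exp (-l) := by
      rw [← Real.exp_add]; congr 1
    have e4 := Real.exp_le_exp.mpr e1
    rw [e3] at e4
    rw [hδl]
    nlinarith [Real.exp_pos (-l)]
  · have e0 : ε * s - q / 2 = -(q / 2 - ε * s) := by ring
    rw [e0]
    refine (pixeldp_tail_neg _ hV _ (by linarith)).trans ?_
    have e1 : 2 * l * q ≤ q / 2 := by nlinarith [mul_pos hε0 hs']
    have e2 : l ≤ 1 / 4 := by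
      by_contra hc
      push Not at hc
      nlinarith
    have e3 : 0.9375 ≤ δ := by
      rw [hδl]
      have := Real.add_one_le_exp (-l)
      linarith
    have hes : s * ε ^ 2 ≤ ε * s := by nlinarith [mul_pos hε0 hs']
    have hlq : 0.4 * (q:ℝ) ≤ 2 * l * q := by nlinarith
    have e4 : (q / 2 - ε * s : ℝ) ≤ 0.1 * q := by linarith
    have e5 : (q : ℝ) ≤ 2.5 * s := by nlinarith
    have e6 : (q / 2 - ε * s : ℝ) / Real.sqrt ((q * s : ℝ≥0) : ℝ) ≤ 0.4 := by
      have hsq : 0 < Real.sqrt ((q * s : ℝ≥0) : ℝ) := Real.sqrt_pos.mpr (by positivity)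
      rw [div_le_iff₀ hsq]
      have : 0.25 * (q:ℝ) ≤ Real.sqrt ((q * s : ℝ≥0) : ℝ) := by
        apply Real.le_sqrt_of_sq_le
        push_cast
        nlinarith
      linarith
    linarith

lemma pixeldp_core {m : ℕ} (s : ℝ≥0) (hs : s ≠ 0) (v : Fin m → ℝ) (ε δ : ℝ) (hε0 : 0 < ε)
    (hε1 : ε ≤ 1) (hδ0 : 0 < δ) (hδ1 : δ < 1)
    (h : 2 * Real.log (1.25 / δ) * (∑ i, v i ^ 2) ≤ s * ε ^ 2)
    (T : Set (Fin m → ℝ)) (hT : MeasurableSet T) :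
    ((Measure.pi (fun _ : Fin m => gaussianReal 0 s)).map (fun z => v + z)).real T
      ≤ Real.exp ε * (Measure.pi (fun _ : Fin m => gaussianReal 0 s)).real T + δ := by
  set μ := Measure.pi (fun _ : Fin m => gaussianReal 0 s) with hμ
  have hs' : (0:ℝ) < s := by positivity
  have h0 : 0 ≤ ∑ i, v i ^ 2 := Finset.sum_nonneg (fun i _ => sq_nonneg _)
  rcases h0.eq_or_lt with hv | hv
  · have hv0 : v = 0 := by
      ext i
      have := (Finset.sum_eq_zero_iff_of_nonneg (fun i _ => sq_nonneg (v i))).mp hv.symm i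
        (Finset.mem_univ i)
      simpa using this
    subst hv0
    simp only [zero_add, Measure.map_id']
    have : 1 ≤ Real.exp ε := Real.one_le_exp hε0.le
    have h3 : 0 ≤ μ.real T := measureReal_nonneg
    nlinarith
  have : IsProbabilityMeasure (μ.map (fun z => v + z)) :=
    Measure.isProbabilityMeasure_map (by fun_prop)
  have hin : Measurable (fun z : Fin m → ℝ => ∑ i, v i * z i) := by fun_prop
  let B : Set (Fin m → ℝ) := {z | ∑ i, v i * z i ≤ ε * s + (∑ i, v i ^ 2) / 2}
  have hB : MeasurableSet B := measurableSet_le hin measurable_const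
  have hsplit : (μ.map (fun z => v + z)).real T
      ≤ (μ.map (fun z => v + z)).real (T ∩ B) + (μ.map (fun z => v + z)).real Bᶜ := by
    refine le_trans (measureReal_mono ?_) (measureReal_union_le _ _)
    intro z hz
    by_cases hzB : z ∈ B
    · exact Or.inl ⟨hz, hzB⟩
    · exact Or.inr hzB
  have hgood : (μ.map (fun z => v + z)).real (T ∩ B) ≤ Real.exp ε * μ.real T := by
    have : (μ.map (fun z => v + z)) (T ∩ B) ≤ ENNReal.ofReal (Real.exp ε) * μ T := by
      rw [hμ, pixeldp_map_shift s hs v, ← hμ, withDensity_apply _ (hT.inter hB)]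
      calc _ ≤ ∫⁻ z in T ∩ B, ENNReal.ofReal (Real.exp ε) ∂μ := by
            refine setLIntegral_mono (by fun_prop) (fun z hz => ?_)
            apply ENNReal.ofReal_le_ofReal
            apply Real.exp_le_exp.mpr
            have : ∑ i, v i * z i ≤ ε * s + (∑ i, v i ^ 2) / 2 := hz.2
            rw [div_le_iff₀ hs']
            linarith
        _ ≤ _ := by
            rw [setLIntegral_const]
            gcongr
            exact Set.inter_subset_left
    have h3 := ENNReal.toReal_mono (by finiteness) this
    rwa [ENNReal.toReal_mul, ENNReal.toReal_ofReal (by positivity)] at h3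
  have hbad : (μ.map (fun z => v + z)).real Bᶜ ≤ δ := by
    have ht := pixeldp_tail s (∑ i, v i ^ 2).toNNReal hs (by simpa using hv) ε δ hε0 hε1 hδ0 hδ1
      (by rwa [Real.coe_toNNReal _ h0])
    rw [← pixeldp_map_inner, map_measureReal_apply hin measurableSet_Ioi,
      Real.coe_toNNReal _ h0] at ht
    rw [map_measureReal_apply (by fun_prop) hB.compl]
    convert ht using 2
    ext z
    simp only [B, Set.mem_preimage, Set.mem_compl_iff, Set.mem_ofPred_eq, not_le, Set.mem_Ioi,
      Pi.add_apply, mul_add, Finset.sum_add_distrib, ← sq]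
    constructor <;> intro h <;> linarith
  linarith

/-- **Gaussian mechanism**, as used in the PixelDP noise layer.
If `g : ℝⁿ → ℝ^m` has `(p,2)`-sensitivity at most `Δ`, i.e.
`‖g(x) - g(x')‖₂ ≤ Δ·‖x - x'‖_p` for all `x, x'`, and `A(x)` is the law of
`g(x) + Z` with `Z` i.i.d. Gaussian of mean `0` and variance `σ²`, where
`σ = √(2·ln(1.25/δ))·Δ·L/ε` with `ε ∈ (0,1]`, `δ ∈ (0,1)` and `L > 0`, then `A` is
`(ε, δ)`-differentially private with respect to the `p`-norm at distance `L`: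
`A(x)(S) ≤ e^ε · A(x')(S) + δ` whenever `‖x - x'‖_p ≤ L`. -/
theorem gaussian_mechanism_pixeldp
    {n m : ℕ} {p : ℝ≥0∞} [Fact (1 ≤ p)]
    (g : PiLp p (fun _ : Fin n => ℝ) → (Fin m → ℝ))
    (Δ : ℝ) (hΔ : 0 < Δ)
    (hsens : ∀ x x' : PiLp p (fun _ : Fin n => ℝ),
      Real.sqrt (∑ i, (g x i - g x' i) ^ 2) ≤ Δ * ‖x - x'‖)
    (ε δ : ℝ) (hε0 : 0 < ε) (hε1 : ε ≤ 1) (hδ0 : 0 < δ) (hδ1 : δ < 1)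
    (L : ℝ) (hL : 0 < L)
    (σ : ℝ) (hσ : σ = Real.sqrt (2 * Real.log (1.25 / δ)) * Δ * L / ε)
    (A : PiLp p (fun _ : Fin n => ℝ) → Measure (Fin m → ℝ))
    (hA : ∀ x, A x = (gaussianNoise m σ).map (fun z => g x + z)) :
    ∀ x x' : PiLp p (fun _ : Fin n => ℝ), ‖x - x'‖ ≤ L →
      ∀ S : Set (Fin m → ℝ), MeasurableSet S →
        ((A x) S).toReal ≤ Real.exp ε * ((A x') S).toReal + δ := by
  intro x x' hxx S hS
  have hl : 0 < Real.log (1.25 / δ) :=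
    Real.log_pos (by rw [lt_div_iff₀ hδ0]; linarith)
  have hσ0 : 0 < σ := by rw [hσ]; positivity
  have hs : (σ ^ 2).toNNReal ≠ 0 := by
    simpa using hσ0.ne'
  have hsc : (((σ ^ 2).toNNReal : ℝ≥0) : ℝ) = σ ^ 2 := Real.coe_toNNReal _ (sq_nonneg σ)
  have hq0 : 0 ≤ ∑ i, (g x i - g x' i) ^ 2 := Finset.sum_nonneg (fun i _ => sq_nonneg _)
  have hq : ∑ i, (g x i - g x' i) ^ 2 ≤ (Δ * L) ^ 2 := by
    have h1 : Real.sqrt (∑ i, (g x i - g x' i) ^ 2) ≤ Δ * L :=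
      (hsens x x').trans (by gcongr)
    rw [← Real.sq_sqrt hq0]
    gcongr
  have hσε : σ ^ 2 * ε ^ 2 = 2 * Real.log (1.25 / δ) * (Δ * L) ^ 2 := by
    have h2 : Real.sqrt (2 * Real.log (1.25 / δ)) ^ 2 = 2 * Real.log (1.25 / δ) :=
      Real.sq_sqrt (by positivity)
    rw [hσ, div_pow, mul_pow, mul_pow, h2]
    field_simp
  have key := pixeldp_core (σ ^ 2).toNNReal hs (fun i => g x i - g x' i) ε δ hε0 hε1 hδ0 hδ1
    (by
      rw [hsc, hσε]
      gcongr)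
    ((fun z => g x' + z) ⁻¹' S) ((measurable_const_add (g x')) hS)
  have e1 : A x S = ((Measure.pi (fun _ : Fin m => gaussianReal 0 (σ ^ 2).toNNReal)).map
      (fun z => (fun i => g x i - g x' i) + z)) ((fun z => g x' + z) ⁻¹' S) := by
    rw [hA, Measure.map_apply (by fun_prop) hS, Measure.map_apply (by fun_prop)
      ((measurable_const_add (g x')) hS)]
    unfold gaussianNoise
    congr 1
    ext z
    simp only [Set.mem_preimage]
    have : g x' + ((fun i => g x i - g x' i) + z) = g x + z := by
      ext i
      simp only [Pi.add_apply]
      ring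
    rw [this]
  have e2 : A x' S = (Measure.pi (fun _ : Fin m => gaussianReal 0 (σ ^ 2).toNNReal))
      ((fun z => g x' + z) ⁻¹' S) := by
    rw [hA, Measure.map_apply (by fun_prop) hS]
    rfl
  rw [e1, e2]
  exact key
end
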